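/- Let 0 < α < 1, q > 1, t > 0 and let K ≥ 0 be an integer. Then E_α(−t^α) = ∑_{k=0}^{K} ∫_{c_k − r_k}^{c_k + r_k} f(x,t,α) dx + ∫_{q^K}^{∞} f(x,t,α) dx; in particular c_0 − r_0 = 0, c_k + r_k = q^k for all k ≥ 0, and c_k − r_k = q^{k−1} for all k ≥ 1. -/

import Mathlib

open scoped Real
open MeasureTheory

/-- The one-parameter Mittag-Leffler function (real version). -/
noncomputable def mittagLeffler (α x : ℝ) : ℝ :=
  ∑' j : ℕ, x ^ j / Real.Gamma ((j : ℝ) * α + 1)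

/-- The kernel `f(x,t,α) = (sin(απ)/(απ)) · e^{−t x^{−1/α}} / (x² + 2x cos(απ) + 1)`. -/
noncomputable def fKer (x t α : ℝ) : ℝ :=
  (Real.sin (α * π) / (α * π)) *
    Real.exp (-(t * x ^ (-(1 / α)))) / (x ^ 2 + 2 * x * Real.cos (α * π) + 1)

/-- The centers `c₀ = 1/2`, `c_k = (q+1) q^{k−1} / 2` for `k ≥ 1`. -/
noncomputable def cCtr (q : ℝ) : ℕ → ℝ
  | 0 => 1 / 2
  | k + 1 => (q + 1) * q ^ k / 2

/-- The radii `r₀ = 1/2`, `r_k = (q−1) q^{k−1} / 2` for `k ≥ 1`. -/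
noncomputable def rRad (q : ℝ) : ℕ → ℝ
  | 0 => 1 / 2
  | k + 1 => (q - 1) * q ^ k / 2

open Complex in
/-- The jump of `G` between the two horizontal lines `Im w = ± π`. -/
noncomputable def stripJump (G : ℂ → ℂ) (v : ℝ) : ℂ := G (v + π * I) - G (v - π * I)

open Set Complex in
/-- The integral of `G` along the image of the Hankel contour under the logarithm. -/
noncomputable def hankelIntegral (G : ℂ → ℂ) : ℂ :=
  I * (∫ y in (-π)..π, G (1 + y * I)) + ∫ v in Ioi (1 : ℝ), stripJump G v

section ChangeOfVariables

open Set

variable {E : Type*} [NormedAddCommGroup E] [NormedSpace ℝ E]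

lemma image_exp_mul_univ {b : ℝ} (hb : b ≠ 0) :
    (fun v : ℝ => Real.exp (b * v)) '' univ = Ioi 0 := by
  ext x
  simp only [image_univ, mem_range, mem_Ioi]
  constructor
  · rintro ⟨y, rfl⟩
    positivity
  · intro hx
    exact ⟨Real.log x / b, by rw [mul_div_cancel₀ _ hb, Real.exp_log hx]⟩

lemma hasDerivWithinAt_exp_mul (b v : ℝ) (s : Set ℝ) :
    HasDerivWithinAt (fun v : ℝ => Real.exp (b * v)) (b * Real.exp (b * v)) s v := by
  have := ((hasDerivAt_id v).const_mul b).exp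
  simp only [id, mul_one] at this
  simpa [mul_comm] using this.hasDerivWithinAt

lemma injOn_exp_mul {b : ℝ} (hb : b ≠ 0) (s : Set ℝ) :
    InjOn (fun v : ℝ => Real.exp (b * v)) s :=
  fun _ _ _ _ h => mul_left_cancel₀ hb (Real.exp_injective h)

lemma integral_comp_exp_mul (g : ℝ → E) {b : ℝ} (hb : b ≠ 0) :
    ∫ v : ℝ, (|b| * Real.exp (b * v)) • g (Real.exp (b * v)) = ∫ x in Ioi 0, g x := by
  rw [← image_exp_mul_univ hb, integral_image_eq_integral_abs_deriv_smul MeasurableSet.univ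
    (fun v _ => hasDerivWithinAt_exp_mul b v univ) (injOn_exp_mul hb _)]
  simp [abs_mul]

lemma integrable_comp_exp_mul_iff (g : ℝ → E) {b : ℝ} (hb : b ≠ 0) :
    Integrable (fun v : ℝ => (|b| * Real.exp (b * v)) • g (Real.exp (b * v))) ↔
      IntegrableOn g (Ioi 0) := by
  rw [← image_exp_mul_univ hb, integrableOn_image_iff_integrableOn_abs_deriv_smul
    MeasurableSet.univ (fun v _ => hasDerivWithinAt_exp_mul b v univ) (injOn_exp_mul hb _)]
  simp [abs_mul]

end ChangeOfVariables

section GammaKernel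

open Set

lemma integral_exp_neg_mul_exp {t c : ℝ} (ht : 0 < t) (hc : 0 < c) :
    ∫ v : ℝ, Real.exp (-(t * Real.exp v)) * Real.exp (c * v) = t ^ (-c) * Real.Gamma c := by
  have h := Real.integral_rpow_mul_exp_neg_mul_Ioi hc ht
  rw [← integral_comp_exp_mul _ one_ne_zero] at h
  rw [one_div, Real.inv_rpow ht.le, ← Real.rpow_neg ht.le] at h
  rw [← h]
  congr 1 with v
  simp only [abs_one, one_mul, smul_eq_mul]
  rw [← Real.exp_mul, ← Real.exp_add, ← Real.exp_add, ← Real.exp_add]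
  congr 1
  ring

lemma integrable_exp_neg_mul_exp {t c : ℝ} (ht : 0 < t) (hc : 0 < c) :
    Integrable fun v : ℝ => Real.exp (-(t * Real.exp v)) * Real.exp (c * v) := by
  by_contra h
  have h1 := integral_exp_neg_mul_exp ht hc
  rw [integral_undef h] at h1
  have : 0 < t ^ (-c) * Real.Gamma c :=
    mul_pos (Real.rpow_pos_of_pos ht _) (Real.Gamma_pos_of_pos hc)
  linarith

lemma integrableOn_exp_neg_mul_exp {t : ℝ} (ht : 0 < t) (c : ℝ) :
    IntegrableOn (fun v : ℝ => Real.exp (-(t * Real.exp v)) * Real.exp (c * v)) (Ioi 1) := by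
  have h := (integrable_exp_neg_mul_exp ht (c := max c 1) (by positivity)).integrableOn (s := Ioi 1)
  refine h.mono' (by fun_prop) ?_
  refine (ae_restrict_iff' measurableSet_Ioi).2 (Filter.Eventually.of_forall fun v hv => ?_)
  rw [Real.norm_of_nonneg (by positivity)]
  have hv : (1 : ℝ) < v := hv
  gcongr
  exact le_max_left _ _

lemma tendsto_exp_neg_mul_exp {t : ℝ} (ht : 0 < t) (c : ℝ) :
    Filter.Tendsto (fun v : ℝ => Real.exp (-(t * Real.exp v)) * Real.exp (c * v))
      Filter.atTop (nhds 0) := by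
  have h := (tendsto_rpow_mul_exp_neg_mul_atTop_nhds_zero c t ht).comp Real.tendsto_exp_atTop
  refine h.congr fun v => ?_
  simp only [Function.comp_apply]
  rw [← Real.exp_mul, mul_comm, mul_comm v, neg_mul]

end GammaKernel

section Shrinking

open Set Complex Filter Topology

lemma hankelIntegral_eq_integral_stripJump {G : ℂ → ℂ} {C c : ℝ} (hc : 0 < c)
    (hG : DifferentiableOn ℂ G {w | |w.im| ≤ π})
    (hbound : ∀ w : ℂ, |w.im| ≤ π → w.re ≤ 1 → ‖G w‖ ≤ C * Real.exp (c * w.re))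
    (hint : Integrable (stripJump G)) :
    hankelIntegral G = ∫ v, stripJump G v := by
  have hcont : ∀ s : ℝ, |s| ≤ π → Continuous fun v : ℝ => G (v + s * I) := by
    intro s hs
    refine hG.continuousOn.comp_continuous (by fun_prop) fun v => ?_
    simpa using hs
  have hrect : ∀ A : ℝ, ∫ v in A..1, stripJump G v =
      I * (∫ y in (-π)..π, G (1 + y * I)) - I * ∫ y in (-π)..π, G (A + y * I) := by
    intro A
    have h := integral_boundary_rect_eq_zero_of_differentiableOn G (A + (-π : ℝ) * I) (1 + π * I)
      (hG.mono fun w hw => ?_)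
    · have h1 : ∫ v in A..1, stripJump G v =
          (∫ v in A..1, G (v + π * I)) - ∫ v in A..1, G (v + (-π : ℝ) * I) := by
        rw [← intervalIntegral.integral_sub]
        · simp [stripJump, sub_eq_add_neg]
        · exact (hcont π (by rw [abs_of_pos Real.pi_pos])).intervalIntegrable _ _
        · exact (hcont (-π) (by rw [abs_neg, abs_of_pos Real.pi_pos])).intervalIntegrable _ _
      simp at h
      simp at h1
      rw [h1]
      linear_combination -h
    · have := hw.2
      simp [uIcc_of_le (show -π ≤ π by linarith [Real.pi_pos])] at this
      exact abs_le.2 this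
  have hleft : Tendsto (fun A : ℝ => ∫ y in (-π)..π, G (A + y * I)) atBot (𝓝 0) := by
    have hb : Tendsto (fun A : ℝ => C * Real.exp (c * A) * |π - (-π)|) atBot (𝓝 0) := by
      have : Tendsto (fun A : ℝ => Real.exp (c * A)) atBot (𝓝 0) :=
        Real.tendsto_exp_atBot.comp (tendsto_id.const_mul_atBot hc)
      simpa using (this.const_mul C).mul_const |π - (-π)|
    refine squeeze_zero_norm' ?_ hb
    filter_upwards [eventually_le_atBot 1] with A hA
    refine intervalIntegral.norm_integral_le_of_norm_le_const fun y hy => ?_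
    rw [uIoc_of_le (by linarith [Real.pi_pos])] at hy
    simpa using hbound (A + y * I) (by simpa using abs_le.2 ⟨hy.1.le, hy.2⟩) (by simpa using hA)
  have h1 : ∫ v in Iic (1 : ℝ), stripJump G v = I * ∫ y in (-π)..π, G (1 + y * I) := by
    refine tendsto_nhds_unique
      (intervalIntegral_tendsto_integral_Iic 1 hint.integrableOn tendsto_id) ?_
    simp only [id, hrect]
    simpa using (tendsto_const_nhds (x := I * ∫ y in (-π)..π, G (1 + y * I))).sub
      (hleft.const_mul I)
  rw [hankelIntegral, ← h1, ← intervalIntegral.integral_Iic_add_Ioi hint.integrableOn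
    hint.integrableOn]

end Shrinking

section HankelRepresentation

open Set Complex Filter Topology

/-- The integrand `exp (t z) z ^ (-p - 1) dz` of Hankel's formula in the coordinate `w = log z`. -/
noncomputable def hankelKernel (t p : ℝ) (w : ℂ) : ℂ := cexp (t * cexp w) * cexp (-(p * w))

lemma continuous_hankelKernel (t p : ℝ) : Continuous (hankelKernel t p) := by
  unfold hankelKernel
  fun_prop

lemma hasDerivAt_hankelKernel (t p : ℝ) (w : ℂ) :
    HasDerivAt (hankelKernel t p) (t * hankelKernel t (p - 1) w - p * hankelKernel t p w) w := by
  have h1 : HasDerivAt (fun w : ℂ => cexp (t * cexp w)) (cexp (t * cexp w) * (t * cexp w)) w :=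
    ((hasDerivAt_exp w).const_mul (t : ℂ)).cexp
  have h2 : HasDerivAt (fun w : ℂ => cexp (-(p * w))) (cexp (-(p * w)) * (-(p * 1))) w :=
    ((hasDerivAt_id w).const_mul (p : ℂ)).neg.cexp
  refine (h1.mul h2).congr_deriv ?_
  have h3 : cexp (-(((p - 1 : ℝ) : ℂ) * w)) = cexp w * cexp (-(p * w)) := by
    rw [← Complex.exp_add]
    congr 1
    push_cast
    ring
  simp only [hankelKernel, h3]
  ring

lemma norm_hankelKernel (t p : ℝ) (w : ℂ) :
    ‖hankelKernel t p w‖ =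
      Real.exp (t * (Real.exp w.re * Real.cos w.im)) * Real.exp (-(p * w.re)) := by
  rw [hankelKernel, norm_mul, Complex.norm_exp, Complex.norm_exp]
  simp [Complex.exp_re]

lemma stripJump_hankelKernel (t p v : ℝ) :
    stripJump (hankelKernel t p) v =
      ((Real.exp (-(t * Real.exp v)) * Real.exp (-p * v) : ℝ) : ℂ) *
        (-2 * I * Real.sin (π * p)) := by
  have h1 : cexp (-(p * (v + π * I))) = cexp (-p * v) * cexp (-(π * p) * I) := by
    rw [← Complex.exp_add]
    congr 1
    ring
  have h2 : cexp (-(p * (v - π * I))) = cexp (-p * v) * cexp ((π * p) * I) := by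
    rw [← Complex.exp_add]
    congr 1
    ring
  simp only [stripJump, hankelKernel, h1, h2, Complex.exp_add_pi_mul_I, Complex.exp_sub_pi_mul_I]
  push_cast
  rw [Complex.sin]
  simp only [mul_neg]
  linear_combination (cexp (-(t * cexp v)) * cexp (-p * v) *
    (cexp (-(π * p) * I) - cexp ((π * p) * I))) * I_sq

lemma integrableOn_stripJump_hankelKernel {t : ℝ} (ht : 0 < t) (p : ℝ) :
    IntegrableOn (stripJump (hankelKernel t p)) (Ioi 1) := by
  rw [funext (stripJump_hankelKernel t p)]
  exact (integrableOn_exp_neg_mul_exp ht (-p)).ofReal.mul_const _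

lemma hankelIntegral_eq_zero_of_hasDerivAt {G G' : ℂ → ℂ} (hG : ∀ w, HasDerivAt G (G' w) w)
    (hcont : Continuous G') (hint : IntegrableOn (stripJump G') (Ioi 1))
    (hlim : Tendsto (stripJump G) atTop (𝓝 0)) : hankelIntegral G' = 0 := by
  have h1 : ∫ v in Ioi (1 : ℝ), stripJump G' v = 0 - stripJump G 1 := by
    refine integral_Ioi_of_hasDerivAt_of_tendsto' (fun v _ => ?_) hint hlim
    have hp : HasDerivAt (fun v : ℝ => G (v + π * I)) (G' (v + π * I)) v := by
      have := (hG (v + π * I)).comp_add_const (v : ℂ) (π * I)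
      exact this.comp_ofReal
    have hm : HasDerivAt (fun v : ℝ => G (v - π * I)) (G' (v - π * I)) v := by
      have := (hG (v - π * I)).comp_sub_const (v : ℂ) (π * I)
      exact this.comp_ofReal
    exact hp.sub hm
  have h2 : ∫ y in (-π)..π, G' (1 + y * I) * I = G (1 + π * I) - G (1 + (-π : ℝ) * I) := by
    refine intervalIntegral.integral_eq_sub_of_hasDerivAt (f := fun y : ℝ => G (1 + y * I))
      (fun y _ => ?_) (Continuous.intervalIntegrable (by fun_prop) _ _)
    have h3 : HasDerivAt (fun z : ℂ => 1 + z * I) I (y : ℂ) := by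
      simpa using ((hasDerivAt_id (y : ℂ)).mul_const I).const_add 1
    exact ((hG (1 + y * I)).comp (y : ℂ) h3).comp_ofReal
  rw [intervalIntegral.integral_mul_const] at h2
  rw [hankelIntegral, h1, mul_comm, h2, stripJump]
  push_cast
  ring_nf

lemma mul_hankelIntegral_hankelKernel {t : ℝ} (ht : 0 < t) (p : ℝ) :
    p * hankelIntegral (hankelKernel t p) = t * hankelIntegral (hankelKernel t (p - 1)) := by
  have hjump : stripJump (fun w => t * hankelKernel t (p - 1) w - p * hankelKernel t p w) =
      fun v => t * stripJump (hankelKernel t (p - 1)) v - p * stripJump (hankelKernel t p) v := by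
    ext v
    simp only [stripJump]
    ring
  have hc := continuous_hankelKernel t
  have h0 := hankelIntegral_eq_zero_of_hasDerivAt (hasDerivAt_hankelKernel t p)
    (by have := hc p; have := hc (p - 1); fun_prop)
    (by
      rw [hjump]
      exact ((integrableOn_stripJump_hankelKernel ht _).const_mul _).sub
        ((integrableOn_stripJump_hankelKernel ht _).const_mul _))
    (by
      rw [funext (stripJump_hankelKernel t p)]
      have := (continuous_ofReal.tendsto 0).comp (tendsto_exp_neg_mul_exp ht (-p))
      simpa using this.mul_const (-2 * I * Real.sin (π * p)))
  rw [hankelIntegral, hjump, integral_sub ((integrableOn_stripJump_hankelKernel ht _).const_mul _)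
    ((integrableOn_stripJump_hankelKernel ht _).const_mul _), intervalIntegral.integral_sub,
    integral_const_mul, integral_const_mul, intervalIntegral.integral_const_mul,
    intervalIntegral.integral_const_mul] at h0
  · simp only [hankelIntegral]
    linear_combination -h0
  · have := hc (p - 1)
    exact Continuous.intervalIntegrable (by fun_prop) _ _
  · have := hc p
    exact Continuous.intervalIntegrable (by fun_prop) _ _

lemma norm_hankelKernel_le_of_re_le_one {t : ℝ} (ht : 0 < t) (p : ℝ) {w : ℂ} (hw : w.re ≤ 1) :
    ‖hankelKernel t p w‖ ≤ Real.exp (t * Real.exp 1) * Real.exp (-p * w.re) := by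
  rw [norm_hankelKernel, neg_mul]
  gcongr
  calc Real.exp w.re * Real.cos w.im ≤ Real.exp w.re * 1 := by
        gcongr
        exact Real.cos_le_one _
    _ ≤ Real.exp 1 := by
        rw [mul_one]
        gcongr

lemma hankelIntegral_hankelKernel_of_neg {t p : ℝ} (ht : 0 < t) (hp : -1 < p) (hp0 : p < 0) :
    hankelIntegral (hankelKernel t p) = 2 * π * I * (t ^ p / Real.Gamma (p + 1) : ℝ) := by
  have hint : Integrable (stripJump (hankelKernel t p)) := by
    rw [funext (stripJump_hankelKernel t p)]
    exact (integrable_exp_neg_mul_exp ht (neg_pos.2 hp0)).ofReal.mul_const _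
  rw [hankelIntegral_eq_integral_stripJump (neg_pos.2 hp0)
    (fun w _ => (hasDerivAt_hankelKernel t p w).differentiableAt.differentiableWithinAt)
    (fun w _ hw => norm_hankelKernel_le_of_re_le_one ht p hw) hint,
    funext (stripJump_hankelKernel t p), integral_mul_const, integral_complex_ofReal,
    integral_exp_neg_mul_exp ht (neg_pos.2 hp0), neg_neg]
  have hsin : Real.sin (π * p) ≠ 0 := by
    have : Real.sin (π * -p) > 0 := by
      apply Real.sin_pos_of_pos_of_lt_pi <;> nlinarith [Real.pi_pos]
    rw [mul_neg, Real.sin_neg] at this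
    linarith
  have hG : Real.Gamma (p + 1) ≠ 0 := (Real.Gamma_pos_of_pos (by linarith)).ne'
  have hrefl := Real.Gamma_mul_Gamma_one_sub (-p)
  rw [mul_neg, Real.sin_neg, sub_neg_eq_add, add_comm 1 p, div_neg, eq_neg_iff_add_eq_zero] at hrefl
  have key : Real.Gamma (-p) * Real.sin (π * p) = -π / Real.Gamma (p + 1) := by
    rw [eq_div_iff hG]
    linear_combination Real.sin (π * p) * hrefl - div_mul_cancel₀ π hsin
  have key' := congrArg (fun x : ℝ => (x : ℂ)) key
  push_cast at key' ⊢
  linear_combination (-2 * I * ((t ^ p : ℝ) : ℂ)) * key'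

lemma hankelIntegral_hankelKernel_zero (t : ℝ) :
    hankelIntegral (hankelKernel t 0) = 2 * π * I := by
  have hd : DiffContOnCl ℂ (fun z : ℂ => cexp (t * z)) (Metric.ball 0 |Real.exp 1|) :=
    Differentiable.diffContOnCl (by fun_prop)
  have h := hd.circleAverage
  rw [Real.circleAverage_eq_integral_add (-π), intervalIntegral.integral_comp_add_right
    (fun θ => cexp (t * circleMap 0 (Real.exp 1) θ))] at h
  have hmap : ∀ y : ℝ, hankelKernel t 0 (1 + y * I) = cexp (t * circleMap 0 (Real.exp 1) y) := by
    intro y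
    simp [hankelKernel, circleMap, Complex.exp_add]
  have h2 : 2 * π + -π = π := by ring
  have hpi : (π : ℂ) ≠ 0 := by exact_mod_cast Real.pi_ne_zero
  simp only [mul_zero, Complex.exp_zero, zero_add, h2, real_smul] at h
  push_cast at h
  rw [inv_mul_eq_iff_eq_mul₀ (by simp [hpi])] at h
  simp only [hankelIntegral, stripJump_hankelKernel, hmap, h]
  simp
  ring

lemma hankelIntegral_hankelKernel {t : ℝ} (ht : 0 < t) {p : ℝ} (hp : -1 < p) :
    hankelIntegral (hankelKernel t p) = 2 * π * I * (t ^ p / Real.Gamma (p + 1) : ℝ) := by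
  obtain ⟨n, hn⟩ := exists_nat_ge p
  induction n generalizing p with
  | zero =>
    rcases hn.lt_or_eq with h | h
    · exact hankelIntegral_hankelKernel_of_neg ht hp (by simpa using h)
    · simp only [Nat.cast_zero] at h
      subst h
      simp [hankelIntegral_hankelKernel_zero]
  | succ n ih =>
    by_cases hp0 : p ≤ 0
    · rcases hp0.lt_or_eq with h | h
      · exact hankelIntegral_hankelKernel_of_neg ht hp h
      · subst h
        simp [hankelIntegral_hankelKernel_zero]
    push Not at hp0
    have h := mul_hankelIntegral_hankelKernel ht p
    rw [ih (p := p - 1) (by linarith) (by push_cast at hn; linarith)] at h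
    have hpc : (p : ℂ) ≠ 0 := by exact_mod_cast hp0.ne'
    refine mul_left_cancel₀ hpc (h.trans ?_)
    have hr : t * (t ^ (p - 1) / Real.Gamma (p - 1 + 1)) =
        p * (t ^ p / Real.Gamma (p + 1)) := by
      have := (Real.Gamma_pos_of_pos hp0).ne'
      rw [Real.rpow_sub_one ht.ne', sub_add_cancel, Real.Gamma_add_one hp0.ne']
      field_simp
    have hr' := congrArg (fun x : ℝ => (x : ℂ)) hr
    push_cast at hr' ⊢
    linear_combination (2 * π * I) * hr'

end HankelRepresentation

section MittagLefflerKernel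

open Set Complex Filter Topology

/-- The integrand of the Hankel representation of `E_α (-t ^ α)` in the coordinate `w = log z`. -/
noncomputable def mittagLefflerKernel (t α : ℝ) (w : ℂ) : ℂ :=
  cexp (t * cexp w) * (cexp (α * w) / (1 + cexp (α * w)))

lemma sin_le_norm_one_add_cexp {α : ℝ} (hα0 : 0 < α) (hα1 : α < 1) {w : ℂ} (hw : |w.im| ≤ π) :
    Real.sin (α * π) ≤ ‖1 + cexp (α * w)‖ := by
  have hcos : Real.cos (α * π) ≤ Real.cos (α * w.im) := by
    rw [← Real.cos_abs (α * w.im), abs_mul, abs_of_pos hα0]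
    exact Real.cos_le_cos_of_nonneg_of_le_pi (by positivity) (by nlinarith [Real.pi_pos])
      (by gcongr)
  refine Real.le_sqrt_of_sq_le ?_ |>.trans_eq (Complex.norm_def _).symm
  simp only [normSq_apply, add_re, one_re, exp_re, mul_re, ofReal_re, ofReal_im, zero_mul, sub_zero,
    mul_im, add_zero, add_im, one_im, exp_im, zero_add]
  set r := Real.exp (α * w.re)
  have hr : 0 < r := Real.exp_pos _
  calc Real.sin (α * π) ^ 2 ≤ 1 + 2 * (r * Real.cos (α * w.im)) + r ^ 2 := by
        linarith [Real.sin_sq_add_cos_sq (α * π), sq_nonneg (r + Real.cos (α * π)),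
          mul_le_mul_of_nonneg_left hcos hr.le]
    _ = _ := by linear_combination -r ^ 2 * Real.sin_sq_add_cos_sq (α * w.im)

lemma sin_mul_pi_pos {α : ℝ} (hα0 : 0 < α) (hα1 : α < 1) : 0 < Real.sin (α * π) :=
  Real.sin_pos_of_pos_of_lt_pi (by positivity) (by nlinarith [Real.pi_pos])

lemma one_add_cexp_ne_zero {α : ℝ} (hα0 : 0 < α) (hα1 : α < 1) {w : ℂ} (hw : |w.im| ≤ π) :
    1 + cexp (α * w) ≠ 0 :=
  norm_pos_iff.1 ((sin_mul_pi_pos hα0 hα1).trans_le (sin_le_norm_one_add_cexp hα0 hα1 hw))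

lemma differentiableOn_mittagLefflerKernel (t : ℝ) {α : ℝ} (hα0 : 0 < α) (hα1 : α < 1) :
    DifferentiableOn ℂ (mittagLefflerKernel t α) {w | |w.im| ≤ π} := by
  intro w hw
  have := one_add_cexp_ne_zero hα0 hα1 hw
  unfold mittagLefflerKernel
  exact DifferentiableAt.differentiableWithinAt (by fun_prop (disch := assumption))

lemma norm_mittagLefflerKernel_le (t : ℝ) {α : ℝ} (hα0 : 0 < α) (hα1 : α < 1) {w : ℂ}
    (hw : |w.im| ≤ π) :
    ‖mittagLefflerKernel t α w‖ ≤
      Real.exp (t * (Real.exp w.re * Real.cos w.im)) *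
        (Real.exp (α * w.re) / Real.sin (α * π)) := by
  have h1 := sin_le_norm_one_add_cexp hα0 hα1 hw
  have h2 := sin_mul_pi_pos hα0 hα1
  rw [mittagLefflerKernel, norm_mul, norm_div, Complex.norm_exp, Complex.norm_exp]
  simp only [re_ofReal_mul, exp_re]
  gcongr

lemma norm_mittagLefflerKernel_le_of_re_le_one {t α : ℝ} (ht : 0 < t) (hα0 : 0 < α) (hα1 : α < 1)
    {w : ℂ} (hw : |w.im| ≤ π) (hre : w.re ≤ 1) :
    ‖mittagLefflerKernel t α w‖ ≤
      (Real.exp (t * Real.exp 1) / Real.sin (α * π)) * Real.exp (α * w.re) := by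
  have h2 := sin_mul_pi_pos hα0 hα1
  refine (norm_mittagLefflerKernel_le t hα0 hα1 hw).trans ?_
  rw [div_mul_eq_mul_div, mul_div_assoc]
  gcongr
  calc Real.exp w.re * Real.cos w.im ≤ Real.exp w.re * 1 := by
        gcongr
        exact Real.cos_le_one _
    _ ≤ Real.exp 1 := by
        rw [mul_one]
        gcongr

lemma integrable_stripJump_mittagLefflerKernel {t α : ℝ} (ht : 0 < t) (hα0 : 0 < α)
    (hα1 : α < 1) : Integrable (stripJump (mittagLefflerKernel t α)) := by
  have key : ∀ s : ℝ, |s| ≤ π → Real.cos s = -1 →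
      Integrable fun v : ℝ => mittagLefflerKernel t α (v + s * I) := by
    intro s hs hcos
    refine ((integrable_exp_neg_mul_exp ht hα0).div_const (Real.sin (α * π))).mono' ?_ ?_
    · refine Continuous.aestronglyMeasurable ?_
      refine (differentiableOn_mittagLefflerKernel t hα0 hα1).continuousOn.comp_continuous
        (by fun_prop) fun v => ?_
      simpa using hs
    · refine Eventually.of_forall fun v => ?_
      refine (norm_mittagLefflerKernel_le t hα0 hα1 (by simpa using hs)).trans_eq ?_
      simp [hcos, mul_div_assoc]
  have h := (key π (by rw [abs_of_pos Real.pi_pos]) Real.cos_pi).sub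
    (key (-π) (by rw [abs_neg, abs_of_pos Real.pi_pos]) (by simp))
  refine h.congr (Eventually.of_forall fun v => ?_)
  simp [stripJump, sub_eq_add_neg]

lemma stripJump_mittagLefflerKernel {t α : ℝ} (hα0 : 0 < α) (hα1 : α < 1) (v : ℝ) :
    stripJump (mittagLefflerKernel t α) v =
      (2 * π * I) * (((|-α| * Real.exp (-α * v)) • fKer (Real.exp (-α * v)) t α : ℝ) : ℂ) := by
  have hp : 1 + cexp (α * (v + π * I)) ≠ 0 :=
    one_add_cexp_ne_zero hα0 hα1 (by simp [abs_of_pos Real.pi_pos])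
  have hm : 1 + cexp (α * (v - π * I)) ≠ 0 :=
    one_add_cexp_ne_zero hα0 hα1 (by simp [abs_of_pos Real.pi_pos])
  have hpe : cexp (α * (v + π * I)) =
      cexp (α * v) * (Complex.cos (α * π) + Complex.sin (α * π) * I) := by
    rw [← Complex.exp_mul_I, ← Complex.exp_add]
    congr 1
    ring
  have hme : cexp (α * (v - π * I)) =
      cexp (α * v) * (Complex.cos (α * π) - Complex.sin (α * π) * I) := by
    have := Complex.exp_mul_I (-(α * π))
    rw [Complex.cos_neg, Complex.sin_neg, neg_mul (Complex.sin _), ← sub_eq_add_neg] at this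
    rw [← this, ← Complex.exp_add]
    congr 1
    ring
  have hrpow : Real.exp (-α * v) ^ (-(1 / α)) = Real.exp v := by
    rw [← Real.exp_mul]
    congr 1
    field_simp
  have hinv : Real.exp (-α * v) = (Real.exp (α * v))⁻¹ := by
    rw [neg_mul, Real.exp_neg]
  have hu : cexp (α * v) ≠ 0 := Complex.exp_ne_zero _
  have hαc : (α : ℂ) ≠ 0 := by exact_mod_cast hα0.ne'
  have hpi : (π : ℂ) ≠ 0 := by exact_mod_cast Real.pi_ne_zero
  simp only [stripJump, mittagLefflerKernel, fKer, hrpow, abs_neg, abs_of_pos hα0, smul_eq_mul,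
    Complex.exp_add_pi_mul_I, Complex.exp_sub_pi_mul_I]
  rw [hinv]
  push_cast
  rw [hpe] at hp ⊢
  rw [hme] at hm ⊢
  have hden : (1 + cexp (α * v) * (Complex.cos (α * π) + Complex.sin (α * π) * I)) *
      (1 + cexp (α * v) * (Complex.cos (α * π) - Complex.sin (α * π) * I)) =
      1 + 2 * cexp (α * v) * Complex.cos (α * π) + cexp (α * v) ^ 2 := by
    linear_combination (cexp (α * v)) ^ 2 * Complex.sin_sq_add_cos_sq (α * π) -
      cexp (α * v) ^ 2 * Complex.sin (α * π) ^ 2 * I_sq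
  have hden0 := hden ▸ mul_ne_zero hp hm
  have hrhs : (cexp (α * v))⁻¹ ^ 2 + 2 * (cexp (α * v))⁻¹ * Complex.cos (α * π) + 1 =
      (1 + 2 * cexp (α * v) * Complex.cos (α * π) + cexp (α * v) ^ 2) / cexp (α * v) ^ 2 := by
    field_simp
  rw [hrhs, ← mul_sub, div_sub_div _ _ hp hm, hden, mul_neg]
  field_simp
  ring

lemma integrableOn_fKer {t α : ℝ} (ht : 0 < t) (hα0 : 0 < α) (hα1 : α < 1) :
    IntegrableOn (fun x => fKer x t α) (Ioi 0) := by
  rw [← integrable_comp_exp_mul_iff _ (neg_ne_zero.2 hα0.ne')]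
  have h := (integrable_stripJump_mittagLefflerKernel ht hα0 hα1).const_mul (2 * π * I)⁻¹
  rw [funext (stripJump_mittagLefflerKernel hα0 hα1)] at h
  have hne : (2 * π * I : ℂ) ≠ 0 := two_pi_I_ne_zero
  simp only [inv_mul_cancel_left₀ hne] at h
  exact h.re

lemma hankelIntegral_mittagLefflerKernel {t α : ℝ} (ht : 0 < t) (hα0 : 0 < α) (hα1 : α < 1) :
    hankelIntegral (mittagLefflerKernel t α) =
      2 * π * I * ((∫ x in Ioi 0, fKer x t α : ℝ) : ℂ) := by
  rw [hankelIntegral_eq_integral_stripJump hα0 (differentiableOn_mittagLefflerKernel t hα0 hα1)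
    (fun w hw hre => norm_mittagLefflerKernel_le_of_re_le_one ht hα0 hα1 hw hre)
    (integrable_stripJump_mittagLefflerKernel ht hα0 hα1),
    funext (stripJump_mittagLefflerKernel hα0 hα1), integral_const_mul, integral_complex_ofReal,
    integral_comp_exp_mul (fun x => fKer x t α) (neg_ne_zero.2 hα0.ne')]

lemma hasSum_hankelKernel (t : ℝ) {α : ℝ} (hα0 : 0 < α) {w : ℂ} (hw : 1 ≤ w.re) :
    HasSum (fun j : ℕ => (-1) ^ j * hankelKernel t (j * α) w) (mittagLefflerKernel t α w) := by
  have hlt : ‖-cexp (-(α * w))‖ < 1 := by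
    rw [norm_neg, Complex.norm_exp, Real.exp_lt_one_iff]
    simpa using mul_pos hα0 (by linarith)
  have h := (hasSum_geometric_of_norm_lt_one hlt).mul_left (cexp (t * cexp w))
  have hsum : (1 - -cexp (-(α * w)))⁻¹ = cexp (α * w) / (1 + cexp (α * w)) := by
    have := Complex.exp_ne_zero (α * w)
    rw [sub_neg_eq_add, Complex.exp_neg, ← inv_inv (cexp (α * w) / _), inv_div, add_div,
      div_self this, one_div, add_comm]
  rw [hsum] at h
  refine h.congr_fun fun j => ?_
  rw [hankelKernel, neg_pow (cexp _), ← Complex.exp_nat_mul, mul_left_comm]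
  push_cast
  ring_nf

lemma norm_hankelKernel_natCast_mul_le (t : ℝ) {α : ℝ} (hα0 : 0 < α) {w : ℂ} (hw : 1 ≤ w.re)
    (j : ℕ) :
    ‖(-1) ^ j * hankelKernel t (j * α) w‖ ≤
      Real.exp (t * (Real.exp w.re * Real.cos w.im)) * Real.exp (-α) ^ j := by
  rw [norm_mul, norm_pow, norm_neg, norm_one, one_pow, one_mul, norm_hankelKernel,
    ← Real.exp_nat_mul]
  gcongr
  nlinarith [mul_nonneg (Nat.cast_nonneg (α := ℝ) j) hα0.le]

lemma hasSum_hankelIntegral {t α : ℝ} (ht : 0 < t) (hα0 : 0 < α) :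
    HasSum (fun j : ℕ => (-1) ^ j * hankelIntegral (hankelKernel t (j * α)))
      (hankelIntegral (mittagLefflerKernel t α)) := by
  have hgeom : Summable fun j : ℕ => Real.exp (-α) ^ j :=
    summable_geometric_of_lt_one (Real.exp_pos _).le (by simpa using hα0)
  have harc : HasSum
      (fun j : ℕ => ∫ y in (-π)..π, (-1) ^ j * hankelKernel t (j * α) (1 + y * I))
      (∫ y in (-π)..π, mittagLefflerKernel t α (1 + y * I)) := by
    refine intervalIntegral.hasSum_integral_of_dominated_convergence
      (fun j _ => Real.exp (t * Real.exp 1) * Real.exp (-α) ^ j) (fun j => ?_) (fun j => ?_)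
      ?_ intervalIntegrable_const ?_
    · have := continuous_hankelKernel t (j * α)
      exact Continuous.aestronglyMeasurable (by fun_prop)
    · refine Eventually.of_forall fun y _ => ?_
      refine (norm_hankelKernel_natCast_mul_le t hα0 (by simp) j).trans ?_
      gcongr
      simpa using mul_le_of_le_one_right (Real.exp_pos 1).le (Real.cos_le_one y)
    · exact Eventually.of_forall fun y _ => hgeom.mul_left _
    · exact Eventually.of_forall fun y _ => hasSum_hankelKernel t hα0 (by simp)
  have hray : HasSum
      (fun j : ℕ => ∫ v in Ioi (1 : ℝ), (-1) ^ j * stripJump (hankelKernel t (j * α)) v)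
      (∫ v in Ioi (1 : ℝ), stripJump (mittagLefflerKernel t α) v) := by
    refine hasSum_integral_of_dominated_convergence
      (fun j v => 2 * Real.exp (-(t * Real.exp v)) * Real.exp (-α) ^ j) (fun j => ?_) (fun j => ?_)
      ?_ ?_ ?_
    · exact ((integrableOn_stripJump_hankelKernel ht _).const_mul _).aestronglyMeasurable
    · refine (ae_restrict_iff' measurableSet_Ioi).2 (Eventually.of_forall fun v hv => ?_)
      have hv : (1 : ℝ) < v := hv
      rw [stripJump, mul_sub]
      refine (norm_sub_le _ _).trans ?_
      have h1 := norm_hankelKernel_natCast_mul_le t hα0 (w := v + π * I) (by simpa using hv.le) j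
      have h2 := norm_hankelKernel_natCast_mul_le t hα0 (w := v - π * I) (by simpa using hv.le) j
      simp at h1 h2 ⊢
      linarith
    · exact Eventually.of_forall fun v => hgeom.mul_left _
    · simp only [tsum_mul_left]
      have := (integrableOn_exp_neg_mul_exp ht 0).const_mul 2
      simp only [zero_mul, Real.exp_zero, mul_one] at this
      exact this.mul_const _
    · refine (ae_restrict_iff' measurableSet_Ioi).2 (Eventually.of_forall fun v hv => ?_)
      have hv : (1 : ℝ) < v := hv
      have := (hasSum_hankelKernel t hα0 (w := v + π * I) (by simpa using hv.le)).sub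
        (hasSum_hankelKernel t hα0 (w := v - π * I) (by simpa using hv.le))
      simpa only [stripJump, mul_sub] using this
  refine ((harc.mul_left I).add hray).congr_fun fun j => ?_
  rw [hankelIntegral, intervalIntegral.integral_const_mul, integral_const_mul]
  ring

theorem hasSum_mittagLeffler {t α : ℝ} (ht : 0 < t) (hα0 : 0 < α) (hα1 : α < 1) :
    HasSum (fun j : ℕ => (-(t ^ α)) ^ j / Real.Gamma (j * α + 1))
      (∫ x in Ioi 0, fKer x t α) := by
  have h := hasSum_hankelIntegral ht hα0
  rw [hankelIntegral_mittagLefflerKernel ht hα0 hα1] at h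
  have h' := h.mul_left (2 * π * I)⁻¹
  rw [inv_mul_cancel_left₀ two_pi_I_ne_zero] at h'
  rw [← Complex.hasSum_ofReal]
  refine h'.congr_fun fun j => ?_
  have hj : (-1 : ℝ) < j * α := by
    have : (0 : ℝ) ≤ j * α := by positivity
    linarith
  rw [hankelIntegral_hankelKernel ht hj, mul_left_comm, inv_mul_cancel_left₀ two_pi_I_ne_zero,
    neg_pow, ← Real.rpow_natCast (t ^ α), ← Real.rpow_mul ht.le, mul_comm α]
  push_cast
  ring

end MittagLefflerKernel

section Decomposition

open Set

lemma cCtr_add_rRad (q : ℝ) (k : ℕ) : cCtr q k + rRad q k = q ^ k := by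
  cases k with
  | zero => norm_num [cCtr, rRad]
  | succ k =>
    simp only [cCtr, rRad]
    ring

lemma cCtr_succ_sub_rRad_succ (q : ℝ) (k : ℕ) : cCtr q (k + 1) - rRad q (k + 1) = q ^ k := by
  simp only [cCtr, rRad]
  ring

lemma cCtr_zero_sub_rRad_zero (q : ℝ) : cCtr q 0 - rRad q 0 = 0 := by
  simp [cCtr, rRad]

lemma sum_integral_cCtr_rRad {q : ℝ} (hq : 0 ≤ q) {f : ℝ → ℝ} (hf : IntegrableOn f (Ioi 0))
    (K : ℕ) :
    (∑ k ∈ Finset.range (K + 1), ∫ x in (cCtr q k - rRad q k)..(cCtr q k + rRad q k), f x) =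
      ∫ x in 0..q ^ K, f x := by
  have hint : ∀ a b : ℝ, 0 ≤ a → 0 ≤ b → IntervalIntegrable f volume a b := fun a b ha hb =>
    intervalIntegrable_iff.2 (hf.mono_set fun x hx => (le_min ha hb).trans_lt hx.1)
  induction K with
  | zero => simp [cCtr_zero_sub_rRad_zero, cCtr_add_rRad]
  | succ K ih =>
    rw [Finset.sum_range_succ, ih, cCtr_succ_sub_rRad_succ, cCtr_add_rRad]
    exact intervalIntegral.integral_add_adjacent_intervals
      (hint _ _ le_rfl (by positivity)) (hint _ _ (by positivity) (by positivity))

end Decomposition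

theorem mittagLeffler_decomposition (α q t : ℝ) (hα0 : 0 < α) (hα1 : α < 1) (hq : 1 < q)
    (ht : 0 < t) (K : ℕ) :
    (mittagLeffler α (-(t ^ α)) =
      (∑ k ∈ Finset.range (K + 1),
        ∫ x in (cCtr q k - rRad q k)..(cCtr q k + rRad q k), fKer x t α) +
      ∫ x in Set.Ioi ((q : ℝ) ^ K), fKer x t α) ∧
    cCtr q 0 - rRad q 0 = 0 ∧
    (∀ k : ℕ, cCtr q k + rRad q k = q ^ k) ∧
    (∀ k : ℕ, 1 ≤ k → cCtr q k - rRad q k = q ^ (k - 1)) := by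
  refine ⟨?_, cCtr_zero_sub_rRad_zero q, cCtr_add_rRad q, fun k hk => ?_⟩
  · have hf := integrableOn_fKer ht hα0 hα1
    have hqK : (0 : ℝ) ≤ q ^ K := by positivity
    rw [sum_integral_cCtr_rRad (by linarith) hf, intervalIntegral.integral_of_le hqK,
      ← setIntegral_union Set.Ioc_disjoint_Ioi_same measurableSet_Ioi
        (hf.mono_set Set.Ioc_subset_Ioi_self) (hf.mono_set (Set.Ioi_subset_Ioi hqK)),
      Set.Ioc_union_Ioi_eq_Ioi hqK]
    exact (hasSum_mittagLeffler ht hα0 hα1).tsum_eq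
  · obtain ⟨k, rfl⟩ := Nat.exists_eq_add_of_le' hk
    exact cCtr_succ_sub_rRad_succ q k
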